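/- arXiv:1509.03876 — 7 statements merged into one kernel-verified Lean document; each statement's English description precedes it below -/
import Mathlib

section
/- There exist an absolute constant c > 0 and a function f : ℕ → ℕ such that the following holds. Let G be a residually nilpotent group with a finite symmetric generating set S containing the identity, and suppose there exists an integer n > 1 such that |S^n| ≤ n^{c·log log n}. Then G contains a nilpotent subgroup of index at most f(n) whose nilpotency class is at most log n. -/
open Pointwise

/-- A group is residually nilpotent if every nontrivial element survives in some
nilpotent quotient. -/
def ResiduallyNilpotent (G : Type u) [Group G] : Prop :=
  ∀ g : G, g ≠ 1 → ∃ (N : Type u) (_ : Group N) (π : G →* N),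
    Group.IsNilpotent N ∧ π g ≠ 1

namespace RN

open Pointwise

variable {G : Type*} [Group G]

def Nz (C M : Subgroup G) : Prop := ∀ c ∈ C, ∀ m ∈ M, c * m * c⁻¹ ∈ M

def Cent (C M : Subgroup G) (X : Set G) (h : Nz C M) : Subgroup G where
  carrier := {c | c ∈ C ∧ ∀ x ∈ X, c * x * c⁻¹ * x⁻¹ ∈ M}
  one_mem' := ⟨C.one_mem, fun x _ => by simp⟩
  mul_mem' := by
    rintro a b ⟨ha, ha'⟩ ⟨hb, hb'⟩
    refine ⟨C.mul_mem ha hb, fun x hx => ?_⟩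
    have := M.mul_mem (h a ha _ (hb' x hx)) (ha' x hx)
    convert this using 1
    group
  inv_mem' := by
    rintro a ⟨ha, ha'⟩
    refine ⟨C.inv_mem ha, fun x hx => ?_⟩
    have := h a⁻¹ (C.inv_mem ha) _ (M.inv_mem (ha' x hx))
    convert this using 1
    group

theorem mem_Cent {C M : Subgroup G} {X : Set G} {h : Nz C M} {c : G} :
    c ∈ Cent C M X h ↔ c ∈ C ∧ ∀ x ∈ X, c * x * c⁻¹ * x⁻¹ ∈ M := Iff.rfl

theorem Cent_le {C M : Subgroup G} {X : Set G} {h : Nz C M} : Cent C M X h ≤ C :=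
  fun _ hc => hc.1

def Zc (D : Subgroup G) : ℕ → G → Prop
  | 0, x => x = 1
  | d + 1, x => ∀ y ∈ D, Zc D d (x * y * x⁻¹ * y⁻¹)

theorem Zc_anti {D D' : Subgroup G} (h : D' ≤ D) : ∀ (d : ℕ) (x : G), Zc D d x → Zc D' d x
  | 0, _, hx => hx
  | d + 1, _, hx => fun y hy => Zc_anti h d _ (hx y (h hy))

theorem Zc_ucs (D : Subgroup G) : ∀ (d : ℕ) (x : D), Zc D d (x : G) → x ∈ Subgroup.upperCentralSeries D d
  | 0, x, hx => by
    have : x = 1 := Subtype.ext hx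
    simp [this]
  | d + 1, x, hx => by
    rw [Subgroup.mem_upperCentralSeries_succ_iff]
    intro y
    exact Zc_ucs D d _ (hx y y.2)

theorem genIndex (H C : Subgroup G) {X : Type*} [Finite X] (f : C → X)
    (hf : ∀ a b, f a = f b → (a : G)⁻¹ * b ∈ H) :
    H.relIndex C ≠ 0 ∧ H.relIndex C ≤ Nat.card X := by
  have hinj : Function.Injective (fun q : C ⧸ H.subgroupOf C => f q.out) := by
    intro p q hpq
    have := hf _ _ hpq
    rw [← QuotientGroup.out_eq' p, ← QuotientGroup.out_eq' q]
    rw [QuotientGroup.eq, Subgroup.mem_subgroupOf]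
    simpa using this
  have hfin : Finite (C ⧸ H.subgroupOf C) := Finite.of_injective _ hinj
  constructor
  · exact Nat.card_pos.ne'
  · exact Nat.card_le_card_of_injective _ hinj

theorem inf_index {D H : Subgroup G} {m : ℕ} (hD : D.index ≠ 0) (h0 : H.relIndex D ≠ 0)
    (hm : H.relIndex D ≤ m) : (D ⊓ H).index ≠ 0 ∧ (D ⊓ H).index ≤ D.index * m := by
  have h1 : (D ⊓ H).relIndex D * D.index = (D ⊓ H).index :=
    Subgroup.relIndex_mul_index inf_le_left
  have h2 : (D ⊓ H).relIndex D = H.relIndex D := by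
    rw [inf_comm]; exact Subgroup.inf_relIndex_right H D
  rw [← h1, h2]
  refine ⟨mul_ne_zero h0 hD, ?_⟩
  rw [mul_comm]
  exact Nat.mul_le_mul_left _ hm

theorem finite_pow {A : Set G} (hA : A.Finite) (s : ℕ) : (A ^ s).Finite := by
  induction s with
  | zero => simp
  | succ s ih => rw [pow_succ]; exact ih.mul hA

theorem growth (A : Set G) (hA1 : (1 : G) ∈ A) (hfin : A.Finite) (hinv : A⁻¹ = A)
    (H : Subgroup G) (K : ℕ)
    (hK : ∀ X : Finset G, (↑X ⊆ A ^ K) → (∀ x ∈ X, ∀ y ∈ X, x⁻¹ * y ∈ H → x = y) → X.card ≤ K) :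
    ∀ g ∈ Subgroup.closure A, ∃ a ∈ A ^ K, a⁻¹ * g ∈ H := by
  have hpf : ∀ s, (A ^ s).Finite := fun s => finite_pow hfin s
  let O : ℕ → Set (G ⧸ H) := fun s => (QuotientGroup.mk : G → G ⧸ H) '' (A ^ s)
  have hOf : ∀ s, (O s).Finite := fun s => (hpf s).image _
  have hOm : ∀ s t, s ≤ t → O s ⊆ O t := fun s t h =>
    Set.image_mono (Set.pow_subset_pow_right hA1 h)
  have hOK : (O K).ncard ≤ K := by
    obtain ⟨s', hs', hb⟩ := Set.exists_subset_bijOn (A ^ K) (QuotientGroup.mk : G → G ⧸ H)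
    have hf : s'.Finite := (hpf K).subset hs'
    have := hK hf.toFinset (by simpa using hs') (by
      intro x hx y hy hxy
      exact hb.injOn (by simpa using hx) (by simpa using hy) (QuotientGroup.eq.2 hxy))
    have h2 : O K = (QuotientGroup.mk : G → G ⧸ H) '' s' := hb.image_eq.symm
    rw [h2, Set.InjOn.ncard_image hb.injOn, Set.ncard_eq_toFinset_card _ hf]
    exact this
  have hex : ∃ s < K, O (s + 1) = O s := by
    by_contra hcon
    push Not at hcon
    have : ∀ s ≤ K, s + 1 ≤ (O s).ncard := by
      intro s
      induction s with
      | zero => intro _; simp [O]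
      | succ s ih =>
        intro hs
        have h1 := ih (by omega)
        have h2 : O s ⊂ O (s + 1) := (hOm s (s+1) (by omega)).ssubset_of_ne (hcon s (by omega)).symm
        have := Set.ncard_lt_ncard h2 (hOf _)
        omega
    have := this K le_rfl
    omega
  obtain ⟨s, hs, hO⟩ := hex
  have key : ∀ g ∈ Subgroup.closure A, (QuotientGroup.mk g : G ⧸ H) ∈ O s := by
    have hstep : ∀ x ∈ A, ∀ y : G, (QuotientGroup.mk y : G ⧸ H) ∈ O s →
        (QuotientGroup.mk (x * y) : G ⧸ H) ∈ O s := by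
      rintro x hx y ⟨a, ha, hay⟩
      rw [← hO]
      refine ⟨x * a, ?_, ?_⟩
      · rw [pow_succ']; exact Set.mul_mem_mul hx ha
      · rw [QuotientGroup.eq] at hay ⊢
        simpa [mul_assoc] using hay
    intro g hg
    induction hg using Subgroup.closure_induction_left with
    | one => exact ⟨1, Set.one_mem_pow hA1, rfl⟩
    | mul_left x hx y hy ih => exact hstep x hx y ih
    | inv_mul_cancel x hx y hy ih => exact hstep x⁻¹ (by rw [← hinv]; simpa using hx) y ih
  intro g hg
  obtain ⟨a, ha, hag⟩ := hOm s K hs.le (key g hg)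
  exact ⟨a, ha, QuotientGroup.eq.1 hag⟩

theorem growth_index (A : Set G) (hfin : A.Finite) (H C : Subgroup G) (K : ℕ)
    (hK : ∀ X : Finset G, (↑X ⊆ A ^ K) → (∀ x ∈ X, ∀ y ∈ X, x⁻¹ * y ∈ H → x = y) → X.card ≤ K)
    (hc : ∀ g ∈ C, ∃ a ∈ A ^ K, a⁻¹ * g ∈ H) : H.relIndex C ≠ 0 ∧ H.relIndex C ≤ K := by
  have hpf : (A ^ K).Finite := finite_pow hfin K
  obtain ⟨s', hs', hb⟩ := Set.exists_subset_bijOn (A ^ K) (QuotientGroup.mk : G → G ⧸ H)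
  have hf : s'.Finite := hpf.subset hs'
  have h1 := hK hf.toFinset (by simpa using hs') (by
      intro x hx y hy hxy
      exact hb.injOn (by simpa using hx) (by simpa using hy) (QuotientGroup.eq.2 hxy))
  have hc' : ∀ g : C, ∃ a : s', (a : G)⁻¹ * g ∈ H := by
    rintro ⟨g, hg⟩
    obtain ⟨a, ha, hag⟩ := hc g hg
    obtain ⟨b, hb1, hb2⟩ := hb.surjOn ⟨a, ha, rfl⟩
    refine ⟨⟨b, hb1⟩, ?_⟩
    have := H.mul_mem (QuotientGroup.eq.1 hb2) hag
    simpa using this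
  choose f hf' using hc'
  have : Finite s' := hf
  have := genIndex H C f (by
    intro a b hab
    have h1 := hf' a
    have h2 := hf' b
    rw [hab] at h1
    have := H.mul_mem (H.inv_mem h1) h2
    simpa using this)
  refine ⟨this.1, this.2.trans ?_⟩
  rw [Nat.card_coe_set_eq, Set.ncard_eq_toFinset_card _ hf]
  exact h1

theorem list_move (V : Set G) (hV : ∀ g : G, ∀ v ∈ V, g * v * g⁻¹ ∈ V) [DecidableEq G] (v : G) :
    ∀ (l : List G), (∀ x ∈ l, x ∈ V) → ∀ k ≤ l.count v,
      ∃ l' : List G, (∀ x ∈ l', x ∈ V) ∧ l'.length + k = l.length ∧ l.prod = v ^ k * l'.prod := by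
  intro l
  induction l with
  | nil => intro _ k hk; simp at hk; subst hk; exact ⟨[], by simp, by simp, by simp⟩
  | cons x t ih =>
    intro hl k hk
    have ht : ∀ y ∈ t, y ∈ V := fun y hy => hl y (List.mem_cons_of_mem _ hy)
    have hx : x ∈ V := hl x List.mem_cons_self
    by_cases hxv : x = v
    · subst hxv
      rcases k with _ | k
      · exact ⟨x :: t, hl, by simp, by simp⟩
      · rw [List.count_cons_self] at hk
        obtain ⟨l', h1, h2, h3⟩ := ih ht k (by omega)
        refine ⟨l', h1, by simp; omega, ?_⟩
        rw [List.prod_cons, h3, pow_succ', mul_assoc]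
    · rw [List.count_cons_of_ne hxv] at hk
      obtain ⟨l', h1, h2, h3⟩ := ih ht k hk
      refine ⟨(v ^ k)⁻¹ * x * v ^ k :: l', ?_, by simp; omega, ?_⟩
      · intro y hy
        rcases List.mem_cons.1 hy with rfl | hy
        · simpa using hV (v ^ k)⁻¹ x hx
        · exact h1 y hy
      · rw [List.prod_cons, List.prod_cons, h3]; group

/-- Dietzmann. -/
theorem dietzmann (V : Finset G) (hV : ∀ g : G, ∀ v ∈ V, g * v * g⁻¹ ∈ V) (K T a : ℕ)
    (hK : V.card ≤ K) (ha0 : 0 < a) (haT : a ≤ T) (hVa : ∀ v ∈ V, v ^ a = 1) :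
    ∃ R : Finset G, R.card ≤ (K + 1) ^ (K * T) ∧ ∀ g ∈ Subgroup.closure (V : Set G), g ∈ R := by
  classical
  have hshort : ∀ m : ℕ, ∀ l : List G, l.length = m → (∀ x ∈ l, x ∈ V) → ∃ l' : List G,
      (∀ x ∈ l', x ∈ V) ∧ l'.length ≤ K * T ∧ l'.prod = l.prod := by
    intro m
    induction m using Nat.strong_induction_on with
    | _ m ih =>
      intro l hl hlV
      by_cases hm : m ≤ K * T
      · exact ⟨l, hlV, by omega, rfl⟩
      · have : ∃ v ∈ V, a ≤ l.count v := by
          by_contra hcon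
          push Not at hcon
          have h1 : l.length = ∑ v ∈ V, l.count v := by
            have := Multiset.sum_count_eq_card (s := V) (m := (l : Multiset G)) (by simpa using hlV)
            simpa using this.symm
          have h2 : ∑ v ∈ V, l.count v ≤ ∑ v ∈ V, T :=
            Finset.sum_le_sum fun v hv => by have := hcon v hv; omega
          rw [Finset.sum_const, smul_eq_mul] at h2
          have h3 : V.card * T ≤ K * T := Nat.mul_le_mul_right _ hK
          omega
        obtain ⟨v, hv, hav⟩ := this
        obtain ⟨l', h1, h2, h3⟩ := list_move (V : Set G) hV v l hlV a hav
        obtain ⟨l'', h4, h5, h6⟩ := ih l'.length (by omega) l' rfl h1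
        refine ⟨l'', h4, h5, ?_⟩
        rw [h6, h3, hVa v hv, one_mul]
  have hlist : ∀ g ∈ Subgroup.closure (V : Set G), ∃ l : List G, (∀ x ∈ l, x ∈ V) ∧ l.prod = g := by
    intro g hg
    induction hg using Subgroup.closure_induction_left with
    | one => exact ⟨[], by simp, by simp⟩
    | mul_left x hx y hy ih =>
      obtain ⟨l, h1, h2⟩ := ih
      refine ⟨x :: l, ?_, by simp [h2]⟩
      intro z hz
      rcases List.mem_cons.1 hz with rfl | hz
      · exact hx
      · exact h1 z hz
    | inv_mul_cancel x hx y hy ih =>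
      obtain ⟨l, h1, h2⟩ := ih
      refine ⟨List.replicate (a - 1) x ++ l, ?_, ?_⟩
      · intro z hz
        rcases List.mem_append.1 hz with hz | hz
        · rw [List.eq_of_mem_replicate hz]; exact hx
        · exact h1 z hz
      · rw [List.prod_append, List.prod_replicate, h2]
        congr 1
        rw [eq_inv_iff_mul_eq_one, ← pow_succ, Nat.sub_add_cancel ha0]
        exact hVa x hx
  refine ⟨(insert 1 V) ^ (K * T), ?_, ?_⟩
  · refine Finset.card_pow_le.trans (Nat.pow_le_pow_left ?_ _)
    exact (Finset.card_insert_le _ _).trans (by omega)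
  · intro g hg
    obtain ⟨l, h1, h2⟩ := hlist g hg
    obtain ⟨l', h3, h4, h5⟩ := hshort _ l rfl h1
    have : l'.prod ∈ (insert 1 V) ^ l'.length := by
      clear h4 h5
      induction l' with
      | nil => simp
      | cons x t ih =>
        rw [List.prod_cons, List.length_cons, pow_succ']
        refine Finset.mul_mem_mul ?_ (ih fun y hy => h3 y (List.mem_cons_of_mem _ hy))
        exact Finset.mem_insert_of_mem (h3 x List.mem_cons_self)
    rw [← h2, ← h5]
    exact Finset.pow_subset_pow_right (Finset.mem_insert_self _ _) h4 this


theorem pow_inv_mem {S : Set G} (hi : S⁻¹ = S) {m : ℕ} {a : G} (ha : a ∈ S ^ m) :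
    a⁻¹ ∈ S ^ m := by
  rw [← hi, inv_pow]; simpa using ha

theorem pow_mul_mem {S : Set G} (h1 : (1 : G) ∈ S) {i j m : ℕ} {a b : G} (ha : a ∈ S ^ i)
    (hb : b ∈ S ^ j) (h : i + j ≤ m) : a * b ∈ S ^ m := by
  refine Set.pow_subset_pow_right h1 h ?_
  rw [pow_add]; exact Set.mul_mem_mul ha hb

theorem radius {S : Set G} (hS : S.Finite) (hi : S⁻¹ = S) (h1 : (1 : G) ∈ S)
    (hcl : Subgroup.closure S = ⊤) (C : Subgroup G) (D r : ℕ) (h0 : C.index ≠ 0)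
    (hD : C.index ≤ D) (hr : 2 * D ≤ r) : C ≤ Subgroup.closure ((C : Set G) ∩ S ^ r) := by
  have hfin : Finite (G ⧸ C) := @Subgroup.finite_quotient_of_finiteIndex _ _ C ⟨h0⟩
  have key := growth S h1 hS hi (Subgroup.closure ((C : Set G) ∩ S ^ r)) D (by
    intro X hX hXe
    refine le_trans ?_ hD
    have : Function.Injective (fun x : X => (QuotientGroup.mk (x : G) : G ⧸ C)) := by
      rintro ⟨x, hx⟩ ⟨y, hy⟩ hxy
      refine Subtype.ext (hXe x hx y hy (Subgroup.subset_closure ⟨QuotientGroup.eq.1 hxy, ?_⟩))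
      exact pow_mul_mem h1 (pow_inv_mem hi (hX hx)) (hX hy) (by omega)
    have := Nat.card_le_card_of_injective _ this
    simpa [Subgroup.index] using this)
  intro c hc
  obtain ⟨a, ha, hac⟩ := key c (by rw [hcl]; trivial)
  have hle : Subgroup.closure ((C : Set G) ∩ S ^ r) ≤ C := by
    rw [Subgroup.closure_le]; exact Set.inter_subset_left
  have haC : a ∈ C := by
    have := C.mul_mem hc (C.inv_mem (hle hac))
    simpa using this
  have : a ∈ Subgroup.closure ((C : Set G) ∩ S ^ r) :=
    Subgroup.subset_closure ⟨haC, Set.pow_subset_pow_right h1 (by omega) ha⟩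
  have := Subgroup.mul_mem _ this hac
  simpa using this

theorem resid (hG : ResiduallyNilpotent G) (A : Set G) (hA : A.Finite) :
    ∃ L, ∀ g ∈ A, g ∈ Subgroup.lowerCentralSeries (⊤ : Subgroup G) L → g = 1 := by
  induction A, hA using Set.Finite.induction_on with
  | empty => exact ⟨0, by simp⟩
  | @insert a A ha hA ih =>
    obtain ⟨L, hL⟩ := ih
    have : ∃ L', a ∈ Subgroup.lowerCentralSeries (⊤ : Subgroup G) L' → a = 1 := by
      by_cases h : a = 1
      · exact ⟨0, fun _ => h⟩
      · obtain ⟨N, _, π, hN, hπ⟩ := hG a h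
        obtain ⟨n, hn⟩ := Subgroup.nilpotent_iff_lowerCentralSeries.1 hN
        refine ⟨n, fun hm => absurd ?_ hπ⟩
        have := Subgroup.mem_map_of_mem π hm
        rw [Subgroup.map_lowerCentralSeries] at this
        replace this := Subgroup.lowerCentralSeries_mono n le_top this
        beta_reduce at this
        rw [hn] at this
        simpa using this
    obtain ⟨L', hL'⟩ := this
    refine ⟨max L L', ?_⟩
    intro g hg hm
    rcases hg with rfl | hg
    · exact hL' (Subgroup.lowerCentralSeries_antitone _ (le_max_right _ _) hm)
    · exact hL g hg (Subgroup.lowerCentralSeries_antitone _ (le_max_left _ _) hm)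

theorem cover_index {C N E D : Subgroup G} (hEC : E ≤ C) (hDC : D ≤ C)
    (hE : Nz C E) (hN : Nz C N) (R : Finset G) (hR : ∀ r ∈ R, r ∈ E) (m : ℕ) (hm : R.card ≤ m)
    (hc : ∀ e ∈ E, ∃ r ∈ R, r⁻¹ * e ∈ N) :
    (Cent C N E hN).relIndex D ≠ 0 ∧ (Cent C N E hN).relIndex D ≤ m ^ m := by
  have hc' : ∀ (d : D) (r : R), ∃ r' : R, (r' : G)⁻¹ * ((d : G) * r * (d : G)⁻¹) ∈ N := by
    intro d r
    obtain ⟨r', h1, h2⟩ := hc _ (hE d (hDC d.2) r (hR r r.2))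
    exact ⟨⟨r', h1⟩, h2⟩
  choose f hf using hc'
  have := genIndex (Cent C N E hN) D f (by
    intro a b hab
    have haC := hDC a.2
    have hbC := hDC b.2
    have hwC : (a : G)⁻¹ * b ∈ C := C.mul_mem (C.inv_mem haC) hbC
    refine ⟨hwC, ?_⟩
    have hr : ∀ r ∈ R, ((a : G)⁻¹ * b) * r * ((a : G)⁻¹ * b)⁻¹ * r⁻¹ ∈ N := by
      intro r hr
      have h1 := hf a ⟨r, hr⟩
      have h2 := hf b ⟨r, hr⟩
      rw [hab] at h1
      have h3 := N.mul_mem (N.inv_mem h1) h2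
      have h4 := hN _ (C.inv_mem haC) _ h3
      have h5 := hN r (hEC (hR r hr)) _ h4
      convert h5 using 1
      simp only [mul_inv_rev, inv_inv, mul_assoc, inv_mul_cancel_left, mul_inv_cancel_left]
    intro e he
    obtain ⟨r, hrR, hre⟩ := hc e he
    have h1 := hr r hrR
    have h2 := hN r (hEC (hR r hrR)) _ (N.mul_mem (hN _ hwC _ hre) (N.inv_mem hre))
    have h3 := N.mul_mem h1 h2
    convert h3 using 1
    group)
  refine ⟨this.1, this.2.trans ?_⟩
  obtain ⟨r, hr, -⟩ := hc 1 E.one_mem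
  have hpos : 0 < R.card := Finset.card_pos.2 ⟨r, hr⟩
  have : Nat.card (R → R) = R.card ^ R.card := by rw [Nat.card_fun]; simp
  rw [this]
  exact (Nat.pow_le_pow_left hm _).trans (Nat.pow_le_pow_right (by omega) hm)

theorem torsion {C E : Subgroup G} (hEC : E ≤ C) (hE : Nz C E) (v : G) (hv : v ∈ C)
    (K T a : ℕ) (h0 : (Cent C E {v} hE).relIndex C ≠ 0) (hK : (Cent C E {v} hE).relIndex C ≤ K)
    (ha0 : 0 < a) (haT : a ≤ T) (hva : v ^ a ∈ E) :
    ∃ U : Subgroup G, E ≤ U ∧ U ≤ C ∧ Nz C U ∧ v ∈ U ∧ ∃ R : Finset G,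
      (∀ r ∈ R, r ∈ U) ∧ R.card ≤ (K + 1) ^ (K * T) ∧ ∀ u ∈ U, ∃ r ∈ R, r⁻¹ * u ∈ E := by
  classical
  have hnorm : (E.subgroupOf C).Normal := ⟨fun n hn g => by
    rw [Subgroup.mem_subgroupOf] at hn ⊢
    exact hE g g.2 n hn⟩
  let v' : C := ⟨v, hv⟩
  let π : C →* C ⧸ E.subgroupOf C := QuotientGroup.mk' _
  let W : Set (C ⧸ E.subgroupOf C) := Set.range fun c : C => π (c * v' * c⁻¹)
  have hfinq : Finite (C ⧸ (Cent C E {v} hE).subgroupOf C) :=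
    @Subgroup.finite_quotient_of_finiteIndex _ _ _ ⟨h0⟩
  let g : C ⧸ (Cent C E {v} hE).subgroupOf C → C ⧸ E.subgroupOf C :=
    fun q => π (q.out * v' * q.out⁻¹)
  have hπ : ∀ c d : C, c⁻¹ * d ∈ (Cent C E {v} hE).subgroupOf C →
      π (c * v' * c⁻¹) = π (d * v' * d⁻¹) := by
    intro c d h
    rw [Subgroup.mem_subgroupOf] at h
    have h1 := h.2 v rfl
    have h2 := hE v⁻¹ (C.inv_mem hv) _ h1
    have h3 := hE c c.2 _ h2
    refine QuotientGroup.eq.2 ?_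
    rw [Subgroup.mem_subgroupOf]
    convert h3 using 1
    simp [v', mul_assoc]
  have hWg : W ⊆ Set.range g := by
    rintro _ ⟨c, rfl⟩
    refine ⟨QuotientGroup.mk c, ?_⟩
    apply hπ
    rw [← QuotientGroup.eq, QuotientGroup.out_eq']
  have hgf : (Set.range g).Finite := Set.finite_range g
  have hWf : W.Finite := hgf.subset hWg
  have hWK : W.ncard ≤ K := by
    refine (Set.ncard_le_ncard hWg hgf).trans (le_trans ?_ hK)
    rw [← Nat.card_coe_set_eq]
    exact Nat.card_le_card_of_surjective _ Set.rangeFactorization_surjective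
  have hWc : ∀ x, ∀ w ∈ W, x * w * x⁻¹ ∈ W := by
    rintro x _ ⟨c, rfl⟩
    obtain ⟨y, rfl⟩ := QuotientGroup.mk'_surjective _ x
    refine ⟨y * c, ?_⟩
    simp [π, mul_assoc]
  have hWa : ∀ w ∈ W, w ^ a = 1 := by
    rintro _ ⟨c, rfl⟩
    rw [← map_pow, conj_pow]
    refine (QuotientGroup.eq_one_iff _).2 ?_
    rw [Subgroup.mem_subgroupOf]
    exact hE c c.2 _ hva
  obtain ⟨R0, hR0, hcov⟩ := dietzmann hWf.toFinset (by simpa using hWc) K T a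
    (by rw [← Set.ncard_eq_toFinset_card _ hWf]; exact hWK) ha0 haT (by simpa using hWa)
  rw [Set.Finite.coe_toFinset] at hcov
  have hcn : ∀ x, ∀ w ∈ Subgroup.closure W, x * w * x⁻¹ ∈ Subgroup.closure W := by
    intro x w hw
    have h1 : (Subgroup.closure W).map (MulAut.conj x).toMonoidHom ≤ Subgroup.closure W := by
      rw [MonoidHom.map_closure]
      apply Subgroup.closure_mono
      rintro _ ⟨w, hw, rfl⟩
      simpa using hWc x w hw
    have := h1 (Subgroup.mem_map_of_mem _ hw)
    simpa using this
  refine ⟨((Subgroup.closure W).comap π).map C.subtype, ?_, ?_, ?_, ?_, ?_⟩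
  · intro e he
    refine ⟨⟨e, hEC he⟩, ?_, rfl⟩
    have : π ⟨e, hEC he⟩ = 1 := (QuotientGroup.eq_one_iff _).2 he
    show π _ ∈ Subgroup.closure W
    rw [this]; exact Subgroup.one_mem _
  · rintro _ ⟨c, -, rfl⟩; exact c.2
  · rintro c hc _ ⟨u, hu, rfl⟩
    refine ⟨⟨c, hc⟩ * u * ⟨c, hc⟩⁻¹, ?_, rfl⟩
    show π _ ∈ Subgroup.closure W
    rw [map_mul, map_mul, map_inv]
    exact hcn _ _ hu
  · refine ⟨v', ?_, rfl⟩
    exact Subgroup.subset_closure ⟨1, by simp⟩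
  · refine ⟨(R0.filter (· ∈ Subgroup.closure W)).image fun q => ((q.out : C) : G), ?_, ?_, ?_⟩
    · intro r hr
      obtain ⟨q, hq, rfl⟩ := Finset.mem_image.1 hr
      refine ⟨q.out, ?_, rfl⟩
      show π _ ∈ Subgroup.closure W
      have : π q.out = q := QuotientGroup.out_eq' q
      rw [this]
      exact (Finset.mem_filter.1 hq).2
    · exact Finset.card_image_le.trans ((Finset.card_filter_le _ _).trans hR0)
    · rintro _ ⟨u, hu, rfl⟩
      refine ⟨_, Finset.mem_image_of_mem _ (Finset.mem_filter.2 ⟨hcov _ hu, hu⟩), ?_⟩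
      have : (QuotientGroup.mk (π u).out : C ⧸ E.subgroupOf C) = QuotientGroup.mk u :=
        QuotientGroup.out_eq' _
      have := QuotientGroup.eq.1 this
      exact this

theorem inter_pow {S : Set G} (C : Subgroup G) (r K : ℕ) {a : G}
    (ha : a ∈ ((C : Set G) ∩ S ^ r) ^ K) : a ∈ C ∧ a ∈ S ^ (r * K) := by
  constructor
  · have : ∀ m : ℕ, ((C : Set G) ∩ S ^ r) ^ m ⊆ C := by
      intro m
      induction m with
      | zero => simp
      | succ m ih =>
        rw [pow_succ]
        rintro _ ⟨x, hx, y, hy, rfl⟩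
        exact C.mul_mem (ih hx) hy.1
    exact this K ha
  · rw [pow_mul]
    exact Set.pow_subset_pow_left Set.inter_subset_right ha

theorem find_v {S : Set G} (hS : S.Finite) (hi : S⁻¹ = S) (h1 : (1 : G) ∈ S)
    (hG : ResiduallyNilpotent G)
    {C E : Subgroup G} (hE : Nz C E) (hCE : ¬ C ≤ E) (K r ρ : ℕ)
    (hK : 1 ≤ K) (hg : (S ^ (2 * ρ)).ncard ≤ K * (S ^ (ρ / 8)).ncard)
    (hr : r * K ≤ ρ / 4) (hC : C ≤ Subgroup.closure ((C : Set G) ∩ S ^ r)) :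
    ∃ v ∈ C, v ∈ S ^ ρ ∧ v ∉ E ∧ (Cent C E {v} hE).relIndex C ≠ 0 ∧
      (Cent C E {v} hE).relIndex C ≤ K := by
  classical
  have hr1 : r ≤ ρ / 4 := le_trans (Nat.le_mul_of_pos_right r hK) hr
  let γ : ℕ → Subgroup G := fun j => Subgroup.lowerCentralSeries ⊤ j
  have hγs : ∀ j, ∀ c v, v ∈ γ j → c * v * c⁻¹ * v⁻¹ ∈ γ (j + 1) := by
    intro j c v hv
    have := (γ (j+1)).inv_mem (Subgroup.commutator_mem_commutator hv (Subgroup.mem_top c))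
    rw [commutatorElement_inv] at this
    exact this
  have hγn : ∀ j, ∀ c v, v ∈ γ j → c * v * c⁻¹ ∈ γ j := by
    intro j c v hv
    have h2 : (γ j).Normal := Subgroup.lowerCentralSeries_normal ⊤ j
    exact h2.conj_mem v hv c
  obtain ⟨L, hL⟩ := resid hG (S ^ ρ) (finite_pow hS ρ)
  have hex : ∃ j, ∀ x ∈ C, x ∈ S ^ ρ → x ∈ γ j → x ∈ E :=
    ⟨L, fun x _ hx hxL => by rw [hL x hx hxL]; exact E.one_mem⟩
  have hm := Nat.find_spec hex
  have hmin := fun j (hj : j < Nat.find hex) => Nat.find_min hex hj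
  generalize Nat.find hex = m at hm hmin
  rcases m with _ | j
  · exfalso
    apply hCE
    refine hC.trans ?_
    rw [Subgroup.closure_le]
    rintro x ⟨hxC, hx⟩
    exact hm x hxC (Set.pow_subset_pow_right h1 (by omega) hx) trivial
  have hj := hmin j (by omega)
  push Not at hj
  obtain ⟨v, hvC, hvS, hvj, hvE⟩ := hj
  by_cases hA : ∃ v ∈ C, v ∈ S ^ (ρ / 4) ∧ v ∈ γ j ∧ v ∉ E
  · obtain ⟨v, hvC, hvS, hvj, hvE⟩ := hA
    refine ⟨v, hvC, Set.pow_subset_pow_right h1 (by omega) hvS, hvE, ?_⟩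
    have hle : C ≤ Cent C E {v} hE := by
      refine hC.trans ?_
      rw [Subgroup.closure_le]
      rintro c ⟨hcC, hc⟩
      refine ⟨hcC, ?_⟩
      rintro x rfl
      refine hm _ ?_ ?_ (hγs j c x hvj)
      · exact C.mul_mem (C.mul_mem (C.mul_mem hcC hvC) (C.inv_mem hcC)) (C.inv_mem hvC)
      · refine pow_mul_mem h1 (pow_mul_mem h1 (pow_mul_mem h1 hc hvS le_rfl)
          (pow_inv_mem hi hc) le_rfl) (pow_inv_mem hi hvS) ?_
        omega
    rw [Subgroup.relIndex_eq_one.2 hle]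
    exact ⟨one_ne_zero, hK⟩
  · push Not at hA
    refine ⟨v, hvC, hvS, hvE, ?_⟩
    have hX : ∀ X : Finset G, (↑X ⊆ ((C : Set G) ∩ S ^ r) ^ K) →
        (∀ x ∈ X, ∀ y ∈ X, x⁻¹ * y ∈ Cent C E {v} hE → x = y) → X.card ≤ K := by
      intro X hXA hXe
      have hfin := finite_pow hS (ρ / 8)
      have hfin2 := finite_pow hS (2 * ρ)
      have hpos : 0 < hfin.toFinset.card :=
        Finset.card_pos.2 ⟨1, by simpa using Set.one_mem_pow h1⟩
      have hcard : (X ×ˢ hfin.toFinset).card ≤ hfin2.toFinset.card := by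
        refine Finset.card_le_card_of_injOn (fun p => p.1 * v * p.1⁻¹ * p.2) ?_ ?_
        · rintro ⟨a, s⟩ h
          have h := Finset.mem_product.1 h
          have ha := (inter_pow C r K (hXA h.1)).2
          have hs : s ∈ S ^ (ρ / 8) := by simpa using h.2
          simp only [Set.Finite.coe_toFinset]
          refine pow_mul_mem h1 (pow_mul_mem h1 (pow_mul_mem h1 ha hvS le_rfl)
            (pow_inv_mem hi ha) le_rfl) hs ?_
          omega
        · rintro ⟨a, s⟩ h ⟨b, t⟩ h' heq
          have h := Finset.mem_product.1 h
          have h' := Finset.mem_product.1 h'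
          have ha := (inter_pow C r K (hXA h.1)).1
          have hb := (inter_pow C r K (hXA h'.1)).1
          have hs : s ∈ S ^ (ρ / 8) := by simpa using h.2
          have ht : t ∈ S ^ (ρ / 8) := by simpa using h'.2
          simp only at heq h h' ha hb
          have e1 : (b * v * b⁻¹)⁻¹ * (a * v * a⁻¹) = t * s⁻¹ := by
            rw [inv_mul_eq_iff_eq_mul, ← mul_assoc, ← heq]; group
          have e2 : (b * v * b⁻¹)⁻¹ * (a * v * a⁻¹) ∈ E := by
            refine hA _ ?_ ?_ ?_
            · exact C.mul_mem (C.inv_mem (C.mul_mem (C.mul_mem hb hvC) (C.inv_mem hb)))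
                (C.mul_mem (C.mul_mem ha hvC) (C.inv_mem ha))
            · rw [e1]
              exact pow_mul_mem h1 ht (pow_inv_mem hi hs) (by omega)
            · exact (γ j).mul_mem ((γ j).inv_mem (hγn j b v hvj)) (hγn j a v hvj)
          have e3 := hE _ (C.mul_mem hvC (C.inv_mem hb)) _ e2
          have e4 : b = a := by
            refine hXe b h'.1 a h.1 ⟨C.mul_mem (C.inv_mem hb) ha, ?_⟩
            rintro x rfl
            convert e3 using 1
            group
          subst e4
          have : s = t := mul_left_cancel heq
          rw [this]
      rw [Finset.card_product, ← Set.ncard_eq_toFinset_card _ hfin2,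
        ← Set.ncard_eq_toFinset_card _ hfin] at hcard
      rw [← Set.ncard_eq_toFinset_card _ hfin] at hpos
      exact Nat.le_of_mul_le_mul_right (hcard.trans hg) hpos
    refine growth_index _ ((finite_pow hS r).subset Set.inter_subset_right) _ C K hX ?_
    intro g hg'
    refine growth ((C : Set G) ∩ S ^ r) ⟨C.one_mem, Set.one_mem_pow h1⟩
      ((finite_pow hS r).subset Set.inter_subset_right) ?_ _ K hX g (hC hg')
    ext x
    simp only [Set.mem_inv, Set.mem_inter_iff, SetLike.mem_coe, inv_mem_iff]
    refine and_congr Iff.rfl ⟨fun h => by simpa using pow_inv_mem hi h, fun h => pow_inv_mem hi h⟩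

def Valid (S : Set G) (ρ F : ℕ) (C N E : Subgroup G) : Prop :=
  N ≤ E ∧ E ≤ C ∧ Nz C E ∧ ∃ R : Finset G, (∀ r ∈ R, r ∈ E) ∧
    R.card ≤ F ^ ((C : Set G) ∩ S ^ ρ ∩ E).ncard ∧ ∀ e ∈ E, ∃ r ∈ R, r⁻¹ * e ∈ N

theorem exists_max {S : Set G} (hS : S.Finite) (ρ F : ℕ) (hF : 1 ≤ F) {C N : Subgroup G}
    (hNC : N ≤ C) (hN : Nz C N) : ∃ E, Valid S ρ F C N E ∧ ∀ U, Valid S ρ F C N U →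
      ((C : Set G) ∩ S ^ ρ ∩ U).ncard ≤ ((C : Set G) ∩ S ^ ρ ∩ E).ncard := by
  let s : Set ℕ := {m | ∃ E, Valid S ρ F C N E ∧ ((C : Set G) ∩ S ^ ρ ∩ E).ncard = m}
  have hb : BddAbove s := by
    refine ⟨(S ^ ρ).ncard, ?_⟩
    rintro _ ⟨E, -, rfl⟩
    exact Set.ncard_le_ncard (fun x hx => hx.1.2) (finite_pow hS ρ)
  have hne : s.Nonempty := by
    refine ⟨_, N, ⟨le_rfl, hNC, hN, {1}, ?_, ?_, ?_⟩, rfl⟩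
    · simp
    · simpa using Nat.one_le_pow _ _ hF
    · intro e he; exact ⟨1, by simp, by simpa using he⟩
  obtain ⟨E, hE, hEm⟩ := Nat.sSup_mem hne hb
  refine ⟨E, hE, fun U hU => ?_⟩
  rw [hEm]
  exact le_csSup hb (show _ ∈ s from ⟨U, hU, rfl⟩)

theorem max_torsion {S : Set G} (hS : S.Finite) (ρ K T : ℕ) {C N E : Subgroup G}
    (hV : Valid S ρ ((K + 1) ^ (K * T)) C N E)
    (hmax : ∀ U, Valid S ρ ((K + 1) ^ (K * T)) C N U →
      ((C : Set G) ∩ S ^ ρ ∩ U).ncard ≤ ((C : Set G) ∩ S ^ ρ ∩ E).ncard)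
    (hE : Nz C E) (v : G) (hv : v ∈ C) (hvS : v ∈ S ^ ρ) (hvE : v ∉ E)
    (h0 : (Cent C E {v} hE).relIndex C ≠ 0) (hK : (Cent C E {v} hE).relIndex C ≤ K)
    (a : ℕ) (ha0 : 0 < a) (haT : a ≤ T) : v ^ a ∉ E := by
  classical
  intro hva
  obtain ⟨hNE, hEC, -, R, hR, hRc, hcov⟩ := hV
  obtain ⟨U, hEU, hUC, hU, hvU, R', hR', hRc', hcov'⟩ :=
    torsion hEC hE v hv K T a h0 hK ha0 haT hva
  have hlt : ((C : Set G) ∩ S ^ ρ ∩ E).ncard < ((C : Set G) ∩ S ^ ρ ∩ U).ncard := by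
    apply Set.ncard_lt_ncard
    · exact (Set.ssubset_iff_of_subset (Set.inter_subset_inter_right _ hEU)).2
        ⟨v, ⟨⟨hv, hvS⟩, hvU⟩, fun h => hvE h.2⟩
    · exact (finite_pow hS ρ).subset fun x hx => hx.1.2
  refine absurd (hmax U ⟨hNE.trans hEU, hUC, hU, R' * R, ?_, ?_, ?_⟩) (by omega)
  · intro r hr
    obtain ⟨x, hx, y, hy, rfl⟩ := Finset.mem_mul.1 hr
    exact U.mul_mem (hR' x hx) (hEU (hR y hy))
  · refine Finset.card_mul_le.trans ((Nat.mul_le_mul hRc' hRc).trans ?_)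
    rw [← pow_succ']
    exact Nat.pow_le_pow_right (Nat.pos_of_ne_zero (by positivity)) hlt
  · intro u hu
    obtain ⟨r, hr, hru⟩ := hcov' u hu
    obtain ⟨t, ht, htu⟩ := hcov _ hru
    refine ⟨r * t, Finset.mul_mem_mul hr ht, ?_⟩
    simpa [mul_assoc] using htu

structure St (S : Set G) (K T ρ I k : ℕ) (C N D : Subgroup G) (Q : Finset G) : Prop where
  C0 : C.index ≠ 0
  CK : C.index ≤ K ^ k
  NC : N ≤ C
  hN : Nz C N
  DC : D ≤ C
  D0 : D.index ≠ 0
  DI : D.index ≤ I ^ k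
  hZ : ∀ x ∈ N, x ∈ D → Zc D (2 * k) x
  Qc : Q.card = T ^ k
  QS : ∀ q ∈ Q, q ∈ S ^ (k * (T * ρ))
  hQ : ∀ q ∈ Q, ∀ q' ∈ Q, q * q'⁻¹ ∈ C → q * q'⁻¹ ∈ N

theorem step {S : Set G} (hS : S.Finite) (hi : S⁻¹ = S) (h1 : (1 : G) ∈ S)
    (hG : ResiduallyNilpotent G) (hcl : Subgroup.closure S = ⊤) (K T ρ B M k : ℕ)
    (hK : 1 ≤ K)
    (hg : (S ^ (2 * ρ)).ncard ≤ K * (S ^ (ρ / 8)).ncard) (hr : (2 * K ^ B) * K ≤ ρ / 4)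
    (hM : (S ^ ρ).ncard ≤ M) (F' I : ℕ) (hF' : F' = ((K + 1) ^ (K * T)) ^ M)
    (hI : I = F' ^ F' * K) (hk : k < B) (C N D : Subgroup G) (Q : Finset G)
    (hst : St S K T ρ I k C N D Q) :
    (∃ D' : Subgroup G, D'.index ≠ 0 ∧ D'.index ≤ I ^ (k + 1) ∧ ∀ x ∈ D', Zc D' (2 * k + 1) x) ∨
    ∃ C' N' D' Q', St S K T ρ I (k + 1) C' N' D' Q' := by
  classical
  obtain ⟨C0, CK, NC, hN, DC, D0, DI, hZ, Qc, QS, hQ⟩ := hst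
  have hF1 : 1 ≤ (K + 1) ^ (K * T) := Nat.one_le_pow _ _ (by omega)
  obtain ⟨E, hV, hmax⟩ := exists_max hS ρ ((K + 1) ^ (K * T)) hF1 NC hN
  obtain ⟨hNE, hEC, hE, R, hR, hRc, hcov⟩ := id hV
  have hRF : R.card ≤ F' := by
    rw [hF']
    refine hRc.trans (Nat.pow_le_pow_right hF1 (le_trans ?_ hM))
    exact Set.ncard_le_ncard (fun x hx => hx.1.2) (finite_pow hS ρ)
  obtain ⟨hk0, hkF⟩ := cover_index hEC DC hE hN R hR F' hRF hcov
  obtain ⟨hD10, hD1I⟩ := inf_index D0 hk0 hkF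
  set D1 := D ⊓ Cent C N E hN with hD1
  have hEZ : ∀ x ∈ E, x ∈ D1 → Zc D1 (2 * k + 1) x := by
    intro x hx hxD y hy
    refine Zc_anti inf_le_left _ _ (hZ _ ?_ ?_)
    · have := N.inv_mem (hy.2.2 x hx)
      simpa [mul_assoc] using this
    · exact D.mul_mem (D.mul_mem (D.mul_mem hxD.1 hy.1) (D.inv_mem hxD.1)) (D.inv_mem hy.1)
  have hD1I' : D1.index * K ≤ I ^ (k + 1) := by
    rw [pow_succ, hI, ← mul_assoc]
    refine Nat.mul_le_mul_right _ (hD1I.trans ?_)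
    rw [← hI]
    exact Nat.mul_le_mul_right _ DI
  by_cases hCE : C ≤ E
  · left
    exact ⟨D1, hD10, (Nat.le_mul_of_pos_right _ hK).trans hD1I',
      fun x hx => hEZ x (hCE (DC hx.1)) hx⟩
  right
  have hKB : K ^ k ≤ K ^ B := Nat.pow_le_pow_right hK hk.le
  obtain ⟨v, hvC, hvS, hvE, hv0, hvK⟩ := find_v hS hi h1 hG hE hCE K (2 * K ^ B) ρ hK hg hr
    (radius hS hi h1 hcl C (K ^ B) _ C0 (CK.trans hKB) le_rfl)
  have htor := max_torsion hS ρ K T hV hmax hE v hvC hvS hvE hv0 hvK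
  have hC'C : Cent C E {v} hE ≤ C := Cent_le
  have hvC' : v ∈ Cent C E {v} hE := ⟨hvC, by rintro x rfl; simp⟩
  have hnz' : Nz (Cent C E {v} hE) E := fun c hc m hm => hE c (hC'C hc) m hm
  have hC'i := inf_index C0 hv0 hvK
  rw [inf_eq_right.2 hC'C] at hC'i
  have hD1C : D1 ≤ C := inf_le_left.trans DC
  have hvD0 : (Cent C E {v} hE).relIndex D1 ≠ 0 :=
    fun h => hv0 (Subgroup.relIndex_eq_zero_of_le_right hD1C h)
  have hvDK : (Cent C E {v} hE).relIndex D1 ≤ K :=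
    (Subgroup.relIndex_le_of_le_right hD1C hv0).trans hvK
  obtain ⟨hD'0, hD'I⟩ := inf_index hD10 hvD0 hvDK
  have hEN' : ∀ x ∈ E, x ∈ Cent C E {v} hE →
      x ∈ Cent (Cent C E {v} hE) E (Cent C E {v} hE) hnz' := by
    intro x hx hxC
    refine ⟨hxC, fun y hy => ?_⟩
    have := E.mul_mem hx (hE y (hC'C hy) _ (E.inv_mem hx))
    convert this using 1
    group
  have hvN' : v ∈ Cent (Cent C E {v} hE) E (Cent C E {v} hE) hnz' := by
    refine ⟨hvC', fun y hy => ?_⟩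
    have := E.inv_mem (hy.2 v rfl)
    convert this using 1
    group
  have hpowC : ∀ a : ℕ, v ^ a ∈ C := fun a => C.pow_mem hvC a
  have hinj : ∀ a < T, ∀ b < T, ∀ q ∈ Q, ∀ q' ∈ Q, v ^ a * q = v ^ b * q' → a ≤ b → a = b := by
    intro a ha b hb q hq q' hq' heq hab
    by_contra hne
    have e1 : q * q'⁻¹ = v ^ (b - a) := by
      have : v ^ b = v ^ a * v ^ (b - a) := by rw [← pow_add]; congr 1; omega
      rw [this, mul_assoc] at heq
      rw [mul_left_cancel heq]; group
    have e2 := hQ q hq q' hq' (by rw [e1]; exact hpowC _)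
    rw [e1] at e2
    exact htor (b - a) (by omega) (by omega) (hNE e2)
  refine ⟨Cent C E {v} hE, Cent (Cent C E {v} hE) E (Cent C E {v} hE) hnz',
    D1 ⊓ Cent C E {v} hE,
    (Finset.range T ×ˢ Q).image (fun p => v ^ p.1 * p.2), ?_⟩
  constructor
  · exact hC'i.1
  · rw [pow_succ]
    exact hC'i.2.trans (Nat.mul_le_mul_right _ CK)
  · exact Cent_le
  · intro c hc x hx
    have h2 : c * x * c⁻¹ * x⁻¹ ∈ E := by
      have := E.inv_mem (hx.2 c hc)
      convert this using 1
      group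
    have h3 : c * x * c⁻¹ * x⁻¹ ∈ Cent C E {v} hE :=
      mul_mem (mul_mem (mul_mem hc hx.1) (inv_mem hc)) (inv_mem hx.1)
    have := mul_mem (hEN' _ h2 h3) hx
    simpa using this
  · exact inf_le_right
  · exact hD'0
  · exact hD'I.trans hD1I'
  · intro x hx hxD
    show Zc _ (2 * k + 1 + 1) x
    intro y hy
    refine Zc_anti inf_le_left _ _ (hEZ _ (hx.2 y hy.2) ?_)
    exact mul_mem (mul_mem (mul_mem hxD.1 hy.1) (inv_mem hxD.1)) (inv_mem hy.1)
  · rw [Finset.card_image_of_injOn, Finset.card_product, Finset.card_range, Qc, pow_succ']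
    rintro ⟨a, q⟩ h ⟨b, q'⟩ h' heq
    have h := Finset.mem_product.1 h
    have h' := Finset.mem_product.1 h'
    simp only [Finset.mem_range] at h h' heq
    have hab : a = b := by
      rcases le_total a b with hab | hab
      · exact hinj a h.1 b h'.1 q h.2 q' h'.2 heq hab
      · exact (hinj b h'.1 a h.1 q' h'.2 q h.2 heq.symm hab).symm
    subst hab
    rw [mul_left_cancel heq]
  · intro z hz
    obtain ⟨⟨a, q⟩, h, rfl⟩ := Finset.mem_image.1 hz
    have h := Finset.mem_product.1 h
    simp only [Finset.mem_range] at h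
    have h2 : v ^ a ∈ S ^ (ρ * a) := by
      rw [pow_mul]; exact Set.pow_mem_pow hvS
    refine pow_mul_mem h1 h2 (QS q h.2) ?_
    have : ρ * a ≤ T * ρ := by rw [mul_comm]; exact Nat.mul_le_mul_right _ h.1.le
    rw [add_mul]
    omega
  · intro z hz z' hz' hzz
    obtain ⟨⟨a, q⟩, h, rfl⟩ := Finset.mem_image.1 hz
    obtain ⟨⟨b, q'⟩, h', rfl⟩ := Finset.mem_image.1 hz'
    have h := Finset.mem_product.1 h
    have h' := Finset.mem_product.1 h'
    simp only [Finset.mem_range] at h h' hzz ⊢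
    have e0 : v ^ a * q * (v ^ b * q')⁻¹ = v ^ a * (q * q'⁻¹) * (v ^ b)⁻¹ := by group
    rw [e0] at hzz ⊢
    have hva := pow_mem hvN' a
    have hvb := pow_mem hvN' b
    have hqC' : q * q'⁻¹ ∈ Cent C E {v} hE := by
      have := mul_mem (mul_mem (inv_mem hva.1) hzz) hvb.1
      convert this using 1
      group
    have hqE := hNE (hQ q h.2 q' h'.2 (hC'C hqC'))
    exact mul_mem (mul_mem hva (hEN' _ hqE hqC')) (inv_mem hvb)

theorem core {S : Set G} (hS : S.Finite) (hi : S⁻¹ = S) (h1 : (1 : G) ∈ S)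
    (hG : ResiduallyNilpotent G) (hcl : Subgroup.closure S = ⊤) (K T ρ B M : ℕ)
    (hK : 1 ≤ K)
    (hg : (S ^ (2 * ρ)).ncard ≤ K * (S ^ (ρ / 8)).ncard) (hr : (2 * K ^ B) * K ≤ ρ / 4)
    (hM : (S ^ ρ).ncard ≤ M) (hB : (S ^ (B * (T * ρ))).ncard < T ^ B)
    (F' I : ℕ) (hF' : F' = ((K + 1) ^ (K * T)) ^ M) (hI : I = F' ^ F' * K) :
    ∃ D : Subgroup G, D.index ≠ 0 ∧ D.index ≤ I ^ B ∧
      ∃ s ≤ 2 * B, Subgroup.upperCentralSeries D s = ⊤ := by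
  have hI1 : 1 ≤ I := by
    rw [hI, hF']
    exact Nat.pos_of_ne_zero (by positivity)
  have key : ∀ k ≤ B, (∃ D : Subgroup G, D.index ≠ 0 ∧ D.index ≤ I ^ B ∧
      ∃ s ≤ 2 * B, Subgroup.upperCentralSeries D s = ⊤) ∨
      ∃ C N D Q, St S K T ρ I k C N D Q := by
    intro k
    induction k with
    | zero =>
      intro _
      right
      refine ⟨⊤, ⊥, ⊤, {1}, ?_⟩
      constructor
      · simp
      · simp
      · exact bot_le
      · intro c _ m hm
        rw [Subgroup.mem_bot] at hm ⊢
        simp [hm]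
      · exact le_rfl
      · simp
      · simp
      · intro x hx _
        exact Subgroup.mem_bot.1 hx
      · simp
      · simp
      · simp
    | succ k ih =>
      intro hk
      rcases ih (by omega) with h | ⟨C, N, D, Q, hst⟩
      · exact Or.inl h
      rcases step hS hi h1 hG hcl K T ρ B M k hK hg hr hM F' I hF' hI hk C N D Q hst with
        ⟨D', hD0, hDI, hZ⟩ | h
      · left
        refine ⟨D', hD0, hDI.trans (Nat.pow_le_pow_right hI1 hk), 2 * k + 1, by omega, ?_⟩
        rw [eq_top_iff]
        intro x _
        exact Zc_ucs D' _ x (hZ x x.2)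
      · exact Or.inr h
  rcases key B le_rfl with h | ⟨C, N, D, Q, hst⟩
  · exact h
  · exfalso
    have : Q.card ≤ (S ^ (B * (T * ρ))).ncard := by
      rw [← Set.ncard_coe_finset]
      exact Set.ncard_le_ncard (fun q hq => hst.QS q hq) (finite_pow hS _)
    rw [hst.Qc] at this
    omega

theorem numerics (n : ℕ) (hn : 1 < n) (x : ℝ) (hx : x = Real.log (Real.log n)) (h32 : 32 < x)
    (y J : ℕ) (hy : y = ⌊x / 2⌋₊ + 1) (hJ : J = Nat.log (16 ^ 8) n) :
    16 ^ (8 * J) ≤ n ∧ y ^ 2 + y ≤ J ∧ 2 * (y : ℝ) ≤ Real.log n ∧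
      (n : ℝ) ^ (1 / 32 * x) < (16 : ℝ) ^ (y * J) := by
  have hn0 : (0 : ℝ) < n := by positivity
  have hlog : 0 < Real.log n := Real.log_pos (by exact_mod_cast hn)
  have hexp : Real.exp x = Real.log n := by rw [hx, Real.exp_log hlog]
  have h1 : 16 ^ (8 * J) ≤ n := by
    rw [pow_mul, hJ]; exact Nat.pow_log_le_self _ (by omega)
  have h2 : n < 16 ^ (8 * (J + 1)) := by
    rw [pow_mul, hJ]; exact Nat.lt_pow_succ_log_self (by norm_num) _
  have hl16 : Real.log 16 < 3 := by
    have : (16 : ℝ) = 2 ^ 4 := by norm_num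
    rw [this, Real.log_pow]
    have := Real.log_two_lt_d9
    push_cast; linarith
  have hl16p : 0 < Real.log 16 := Real.log_pos (by norm_num)
  have h3 : Real.log n < 8 * ((J : ℝ) + 1) * Real.log 16 := by
    have h2' : (n : ℝ) < 16 ^ (8 * (J + 1)) := by exact_mod_cast h2
    have := Real.log_lt_log hn0 h2'
    rw [Real.log_pow] at this
    push_cast at this
    exact this
  have h4 : Real.log n < 24 * ((J : ℝ) + 1) := by
    have : (0 : ℝ) ≤ J := Nat.cast_nonneg _
    nlinarith
  have h5 : x ^ 4 / 24 ≤ Real.log n := by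
    rw [← hexp]
    have := Real.pow_div_factorial_le_exp x (by linarith) 4
    have h24 : ((Nat.factorial 4 : ℕ) : ℝ) = 24 := by norm_num [Nat.factorial]
    rw [h24] at this
    exact this
  have hyl : x / 2 < y := by
    rw [hy]; push_cast; exact Nat.lt_floor_add_one _
  have hyu : (y : ℝ) ≤ x := by
    rw [hy]; push_cast
    have := Nat.floor_le (show (0 : ℝ) ≤ x / 2 by linarith)
    linarith
  have hx2 : 1024 ≤ x ^ 2 := by nlinarith
  have hx4 : 1024 * x ^ 2 ≤ x ^ 4 := by nlinarith
  have hyJ : y ^ 2 + y ≤ J := by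
    have : ((y ^ 2 + y : ℕ) : ℝ) < ((J + 1 : ℕ) : ℝ) := by
      push_cast
      have : (y : ℝ) ^ 2 ≤ x ^ 2 := by
        have : (0 : ℝ) ≤ y := Nat.cast_nonneg _
        nlinarith
      nlinarith
    have : y ^ 2 + y < J + 1 := by exact_mod_cast this
    omega
  refine ⟨h1, hyJ, ?_, ?_⟩
  · nlinarith
  · have hJ1 : (1 : ℝ) ≤ J := by
      have : 1 ≤ J := by
        have : 1 ≤ y := by omega
        nlinarith
      exact_mod_cast this
    rw [Real.rpow_def_of_pos hn0]
    have : (16 : ℝ) ^ (y * J) = Real.exp (Real.log 16 * (y * J)) := by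
      rw [← Nat.cast_mul, ← Real.rpow_natCast, Real.rpow_def_of_pos (by norm_num)]
    rw [this]
    apply Real.exp_lt_exp.2
    have hb : Real.log n ≤ 16 * J * Real.log 16 := by nlinarith
    calc Real.log n * (1 / 32 * x) ≤ (16 * J * Real.log 16) * (1 / 32 * x) := by
          apply mul_le_mul_of_nonneg_right hb; linarith
      _ = (Real.log 16 * J) * (x / 2) := by ring
      _ < (Real.log 16 * J) * y := by
          apply mul_lt_mul_of_pos_left hyl; positivity
      _ = _ := by ring

theorem pigeon (a : ℕ → ℕ) (K J : ℕ) (h0 : 1 ≤ a 0) (hJ : a J < K ^ J) :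
    ∃ j < J, a (j + 1) ≤ K * a j := by
  by_contra hcon
  push Not at hcon
  have : ∀ j ≤ J, K ^ j ≤ a j := by
    intro j
    induction j with
    | zero => intro _; simpa using h0
    | succ j ih =>
      intro hj
      have h1 := ih (by omega)
      have h2 := hcon j (by omega)
      rw [pow_succ']
      exact (Nat.mul_le_mul_left _ h1).trans h2.le
  have := this J le_rfl
  omega

noncomputable def yy (n : ℕ) : ℕ := ⌊Real.log (Real.log n) / 2⌋₊ + 1

noncomputable def ff (K T M : ℕ) : ℕ := ((K + 1) ^ (K * T)) ^ M

noncomputable def ii (K T M : ℕ) : ℕ := ff K T M ^ ff K T M * K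

noncomputable def bd (n : ℕ) : ℕ :=
  n + ii (16 ^ yy n) (16 ^ (2 * Nat.log (16 ^ 8) n)) (16 ^ (yy n * Nat.log (16 ^ 8) n)) ^ yy n

theorem main {S : Set G} (hS : S.Finite) (hi : S⁻¹ = S) (h1 : (1 : G) ∈ S)
    (hG : ResiduallyNilpotent G) (hcl : Subgroup.closure S = ⊤) (n : ℕ) (hn : 1 < n)
    (h : ((S ^ n).ncard : ℝ) ≤ (n : ℝ) ^ (1 / 32 * Real.log (Real.log n))) :
    ∃ N : Subgroup G, N.index ≠ 0 ∧ N.index ≤ bd n ∧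
      ∃ s : ℕ, (s : ℝ) ≤ Real.log n ∧ Subgroup.upperCentralSeries N s = ⊤ := by
  have hn1 : (1 : ℝ) < n := by exact_mod_cast hn
  have mono : ∀ {a b : ℕ}, a ≤ b → (S ^ a).ncard ≤ (S ^ b).ncard := fun hab =>
    Set.ncard_le_ncard (Set.pow_subset_pow_right h1 hab) (finite_pow hS _)
  by_cases hsmall : (S ^ n).ncard ≤ n
  · have hX : ∀ X : Finset G, (↑X ⊆ S ^ n) →
        (∀ x ∈ X, ∀ y ∈ X, x⁻¹ * y ∈ (⊥ : Subgroup G) → x = y) → X.card ≤ n := by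
      intro X hX _
      refine le_trans ?_ hsmall
      rw [← Set.ncard_coe_finset]
      exact Set.ncard_le_ncard hX (finite_pow hS _)
    have := growth_index S hS ⊥ ⊤ n hX
      (fun g _ => growth S h1 hS hi ⊥ n hX g (by rw [hcl]; trivial))
    rw [Subgroup.relIndex_top_right] at this
    refine ⟨⊥, this.1, this.2.trans (Nat.le_add_right _ _), 0, ?_, ?_⟩
    · simpa using (Real.log_pos hn1).le
    · rw [eq_top_iff]
      intro x _
      have : x = 1 := Subsingleton.elim _ _
      rw [this]; exact one_mem _
  push Not at hsmall
  have h32 : 32 < Real.log (Real.log n) := by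
    by_contra hcon
    push Not at hcon
    have h2 : (n : ℝ) ^ (1 / 32 * Real.log (Real.log n)) ≤ (n : ℝ) ^ (1 : ℝ) :=
      Real.rpow_le_rpow_of_exponent_le hn1.le (by linarith)
    rw [Real.rpow_one] at h2
    have : ((S ^ n).ncard : ℝ) ≤ n := h.trans h2
    have : (S ^ n).ncard ≤ n := by exact_mod_cast this
    omega
  obtain ⟨hJn, hyJ, hylog, hlt⟩ := numerics n hn _ rfl h32 (yy n) _ rfl rfl
  have hy1 : 1 ≤ yy n := Nat.le_add_left _ _
  unfold bd
  generalize yy n = y at *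
  generalize Nat.log (16 ^ 8) n = J at *
  have hSn : (S ^ n).ncard < 16 ^ (y * J) := by
    have := h.trans_lt hlt
    exact_mod_cast this
  have hJ1 : 1 ≤ J := by nlinarith
  have hle : ∀ m ≤ 8 * J, 16 ^ m ≤ n := fun m hm =>
    (Nat.pow_le_pow_right (by norm_num) hm).trans hJn
  have hpos : ∀ m, 1 ≤ (S ^ m).ncard := fun m =>
    (Set.ncard_pos (finite_pow hS m)).2 ⟨1, Set.one_mem_pow h1⟩
  obtain ⟨j, hj, hjK⟩ := pigeon (fun j => (S ^ (2 * (16 ^ j * 16 ^ J))).ncard) (16 ^ y) J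
    (hpos _) (by
      rw [← pow_mul]
      refine lt_of_le_of_lt (mono ?_) hSn
      refine le_trans ?_ (hle (2 * J + 1) (by omega))
      rw [pow_succ, two_mul J, pow_add]
      omega)
  have hρn : 16 * (16 ^ j * 16 ^ J) ≤ 16 ^ (2 * J) := by
    rw [← pow_add, ← pow_succ']
    exact Nat.pow_le_pow_right (by norm_num) (by omega)
  have hp : 16 ^ J ≤ 16 ^ j * 16 ^ J := Nat.le_mul_of_pos_left _ (by positivity)
  have e1 : 2 * (16 ^ (j + 1) * 16 ^ J) = 2 * (16 * (16 ^ j * 16 ^ J)) := by ring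
  simp only [e1] at hjK
  have hKB : (16 ^ y) ^ y * 16 ^ y ≤ 16 ^ J := by
    rw [← pow_mul, ← pow_add]
    exact Nat.pow_le_pow_right (by norm_num) (by nlinarith)
  obtain ⟨D, hD0, hDI, s, hs, hsD⟩ := core hS hi h1 hG hcl (16 ^ y) (16 ^ (2 * J))
    (16 * (16 ^ j * 16 ^ J)) y (16 ^ (y * J)) (Nat.one_le_pow _ _ (by norm_num))
    (by
      have : 16 * (16 ^ j * 16 ^ J) / 8 = 2 * (16 ^ j * 16 ^ J) := by omega
      rw [this]; exact hjK)
    (by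
      rw [mul_assoc]
      omega)
    ((mono (hρn.trans (hle _ (by omega)))).trans hSn.le)
    (by
      have hyy : y ≤ 16 ^ J := by
        have : J < 16 ^ J := Nat.lt_pow_self (by norm_num)
        nlinarith
      refine lt_of_le_of_lt (mono ?_) (hSn.trans_le ?_)
      · refine (Nat.mul_le_mul hyy (Nat.mul_le_mul_left _ hρn)).trans ?_
        rw [← pow_add, ← pow_add]
        exact hle _ (by omega)
      · rw [← pow_mul]
        exact Nat.pow_le_pow_right (by norm_num) (by nlinarith))
    _ _ rfl rfl
  refine ⟨D, hD0, hDI.trans (Nat.le_add_left _ _), s, ?_, hsD⟩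
  refine le_trans ?_ hylog
  exact_mod_cast hs

end RN

theorem statement_4 :
    ∃ (c : ℝ) (f : ℕ → ℕ), 0 < c ∧
      ∀ (G : Type*) [Group G], ResiduallyNilpotent G →
        ∀ S : Set G, S.Finite → S⁻¹ = S → (1 : G) ∈ S → Subgroup.closure S = ⊤ →
          ∀ n : ℕ, 1 < n →
            ((S ^ n).ncard : ℝ) ≤ (n : ℝ) ^ (c * Real.log (Real.log n)) →
            ∃ N : Subgroup G, N.FiniteIndex ∧ N.index ≤ f n ∧
              ∃ s : ℕ, (s : ℝ) ≤ Real.log n ∧ upperCentralSeries ↥N s = ⊤ := by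
  refine ⟨1 / 32, RN.bd, by norm_num, ?_⟩
  intro G _ hG S hS hi h1 hcl n hn h
  obtain ⟨N, h0, hI, s, hs, hu⟩ := RN.main hS hi h1 hG hcl n hn h
  exact ⟨N, ⟨h0⟩, hI, s, hs, hu⟩
end

section
/- Let A be a nonempty finite symmetric subset of a group G, let m, k be positive integers, and let {1} = H_0 ⊆ H_1 ⊆ … ⊆ H_k be a nested sequence of subgroups of G such that for each i = 1,…,k the set A^m ∩ H_i is not contained in A^2·H_{i-1}. Then |A^{m+1}| ≥ k·|A|. -/
open Pointwise

theorem statement_5 {G : Type*} [Group G] (A : Set G) (hfin : A.Finite)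
    (hne : A.Nonempty) (hsym : A⁻¹ = A) (m k : ℕ) (hm : 0 < m) (hk : 0 < k)
    (H : ℕ → Subgroup G) (hH0 : H 0 = ⊥)
    (hnest : ∀ i, i < k → H i ≤ H (i + 1))
    (hnot : ∀ i, 1 ≤ i → i ≤ k →
      ¬ (A ^ m ∩ (H i : Set G) ⊆ A ^ 2 * (H (i - 1) : Set G))) :
    k * A.ncard ≤ (A ^ (m + 1)).ncard := by
  have hex : ∀ i : ℕ, ∃ x : G, i < k →
      x ∈ A ^ m ∧ x ∈ H (i + 1) ∧ x ∉ A ^ 2 * (H i : Set G) := by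
    intro i
    by_cases hi : i < k
    · obtain ⟨x, hx, hx'⟩ := Set.not_subset.1 (hnot (i + 1) (by omega) (by omega))
      exact ⟨x, fun _ => ⟨hx.1, hx.2, hx'⟩⟩
    · exact ⟨1, fun h => absurd h hi⟩
  choose x hx using hex
  have hmono : ∀ i j, i ≤ j → j ≤ k → H i ≤ H j := by
    intro i j hij
    induction j, hij using Nat.le_induction with
    | base => intro _; exact le_rfl
    | succ n hn ih => intro h; exact (ih (by omega)).trans (hnest n (by omega))
  have key : ∀ i j, i < j → j < k → ∀ a ∈ A, ∀ b ∈ A, a * x i = b * x j → False := by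
    intro i j hij hj a ha b hb hab
    apply (hx j hj).2.2
    have hb' : b⁻¹ ∈ A := by rw [← hsym]; simpa using hb
    refine Set.mem_mul.2 ⟨b⁻¹ * a, ?_, x i,
      hmono (i + 1) j hij hj.le (hx i (by omega)).2.1, ?_⟩
    · rw [pow_two]; exact Set.mul_mem_mul hb' ha
    · rw [mul_assoc, hab, inv_mul_cancel_left]
  have hfin' : (A ^ (m + 1)).Finite := by
    generalize m + 1 = n
    induction n with
    | zero => rw [pow_zero]; exact Set.finite_one
    | succ n ih => rw [pow_succ]; exact Set.Finite.mul ih hfin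
  have hcard : ((Set.Iio k) ×ˢ A).ncard = k * A.ncard := by
    rw [Set.ncard_prod]
    congr 1
    rw [← Finset.coe_Iio, Set.ncard_coe_finset, Nat.card_Iio]
  rw [← hcard]
  refine Set.ncard_le_ncard_of_injOn (fun p => p.2 * x p.1) ?_ ?_ hfin'
  · rintro ⟨i, a⟩ ⟨hi, ha⟩
    rw [pow_succ']
    exact Set.mul_mem_mul ha (hx i hi).1
  · rintro ⟨i, a⟩ ⟨hi, ha⟩ ⟨j, b⟩ ⟨hj, hb⟩ hab
    simp only at hab
    rcases lt_trichotomy i j with h | h | h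
    · exact (key i j h hj a ha b hb hab).elim
    · subst h
      rw [mul_right_cancel hab]
    · exact (key j i h hi b hb a ha hab.symm).elim
end

section
/- Let G be a group, let H be a subgroup of G, and let A be a nonempty finite symmetric subset of G. Write |AH/H| for the number of distinct left cosets of H meeting A. Then |A| ≤ |A^2 ∩ H| · |AH/H| ≤ |A^3|. Moreover, A can be covered by |AH/H| left translates of A^2 ∩ H. -/
open Pointwise

theorem statement_7 {G : Type*} [Group G] (H : Subgroup G) (A : Set G)
    (hfin : A.Finite) (hne : A.Nonempty) (hsym : A⁻¹ = A) :
    A.ncard ≤ (A ^ 2 ∩ (H : Set G)).ncard *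
        ((QuotientGroup.mk : G → G ⧸ H) '' A).ncard ∧
    (A ^ 2 ∩ (H : Set G)).ncard * ((QuotientGroup.mk : G → G ⧸ H) '' A).ncard ≤
        (A ^ 3).ncard ∧
    ∃ X : Set G, X.Finite ∧
      X.ncard ≤ ((QuotientGroup.mk : G → G ⧸ H) '' A).ncard ∧
      A ⊆ X * (A ^ 2 ∩ (H : Set G)) := by
  obtain ⟨X, hXA, hbij⟩ :=
    (Set.surjOn_image (QuotientGroup.mk : G → G ⧸ H) A).exists_bijOn_subset
  have hX : X.Finite := hfin.subset hXA
  have hcard : X.ncard = ((QuotientGroup.mk : G → G ⧸ H) '' A).ncard := by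
    rw [← hbij.image_eq, Set.ncard_image_of_injOn hbij.injOn]
  have hA2 : (A ^ 2).Finite := by rw [pow_two]; exact hfin.mul hfin
  have hA3 : (A ^ 3).Finite := by rw [pow_succ]; exact hA2.mul hfin
  have hB : (A ^ 2 ∩ (H : Set G)).Finite := hA2.subset Set.inter_subset_left
  have hcov : A ⊆ X * (A ^ 2 ∩ (H : Set G)) := by
    intro a ha
    obtain ⟨x, hx, hxa⟩ := hbij.surjOn (Set.mem_image_of_mem _ ha)
    refine Set.mem_mul.2 ⟨x, hx, x⁻¹ * a, ⟨?_, QuotientGroup.eq.1 hxa⟩, by group⟩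
    rw [pow_two]
    refine Set.mul_mem_mul ?_ ha
    rw [← hsym]
    exact Set.inv_mem_inv.2 (hXA hx)
  have hmul : (X * (A ^ 2 ∩ (H : Set G))).ncard = (A ^ 2 ∩ (H : Set G)).ncard * X.ncard := by
    rw [← Set.image_mul_prod, Set.ncard_image_of_injOn, Set.ncard_prod, mul_comm]
    rintro ⟨x, b⟩ ⟨hx, hb⟩ ⟨y, c⟩ ⟨hy, hc⟩ h
    simp only at h hx hb hy hc
    have hxy : x = y := by
      apply hbij.injOn hx hy
      rw [← QuotientGroup.mk_mul_of_mem x hb.2, h, QuotientGroup.mk_mul_of_mem y hc.2]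
    subst hxy
    simpa using h
  rw [← hcard, ← hmul]
  refine ⟨Set.ncard_le_ncard hcov (hX.mul hB), Set.ncard_le_ncard ?_ hA3, X, hX, le_rfl, hcov⟩
  rw [pow_succ' A 2]
  exact Set.mul_subset_mul hXA Set.inter_subset_left
end

section
/- Let A be a nonempty finite symmetric subset of a group G, and let H be a subgroup of G such that A^2 ∩ H = {1}. Then for every positive integer m, |A^m ∩ H| ≤ |A^{m+1}| / |A|. -/
open Pointwise

theorem statement_9 {G : Type*} [Group G] (A : Set G) (hfin : A.Finite)
    (hne : A.Nonempty) (hsym : A⁻¹ = A) (H : Subgroup G)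
    (hint : A ^ 2 ∩ (H : Set G) = {1}) (m : ℕ) (hm : 0 < m) :
    ((A ^ m ∩ (H : Set G)).ncard : ℝ) ≤ ((A ^ (m + 1)).ncard : ℝ) / (A.ncard : ℝ) := by
  have hpos : 0 < A.ncard := (Set.ncard_pos hfin).2 hne
  rw [le_div_iff₀ (by exact_mod_cast hpos)]
  have hpow : ∀ n : ℕ, (A ^ n).Finite := by
    intro n
    induction n with
    | zero => rw [pow_zero]; exact Set.finite_one
    | succ k ih => rw [pow_succ]; exact ih.mul hfin
  have key : ((A ^ m ∩ (H : Set G)) ×ˢ A).ncard ≤ (A ^ (m + 1)).ncard := by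
    refine Set.ncard_le_ncard_of_injOn (fun p => p.1 * p.2) ?_ ?_ (hpow _)
    · rintro ⟨h, a⟩ ⟨⟨h1, _⟩, h2⟩
      rw [pow_succ]
      exact Set.mul_mem_mul h1 h2
    · rintro ⟨h, a⟩ ⟨⟨_, h1⟩, ha⟩ ⟨k, b⟩ ⟨⟨_, k1⟩, hb⟩ e
      simp only at e h1 k1 ha hb
      have e1 : a * b⁻¹ = h⁻¹ * k := by
        rw [mul_inv_eq_iff_eq_mul, mul_assoc, ← e]; group
      have hb' : b⁻¹ ∈ A := by rw [← hsym]; simpa using hb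
      have hmem : a * b⁻¹ ∈ A ^ 2 ∩ (H : Set G) := by
        refine ⟨?_, ?_⟩
        · rw [pow_two]; exact Set.mul_mem_mul ha hb'
        · rw [e1]; exact H.mul_mem (H.inv_mem h1) k1
      rw [hint, Set.mem_singleton_iff] at hmem
      have hab : a = b := mul_inv_eq_one.1 hmem
      rw [e1] at hmem
      have hhk : h = k := inv_mul_eq_one.1 hmem
      rw [hab, hhk]
  rw [Set.ncard_prod] at key
  exact_mod_cast key
end

section
/- Let G be a finitely generated nilpotent group and let A be a symmetric subset of G such that G = A·Z(G), where Z(G) is the centre of G. Then there exist an integer r ≥ 0 and subgroups [G,G] = Γ_1 ⊇ Γ_2 ⊇ … ⊇ Γ_r ⊇ Γ_{r+1} = {1}, each normal in G and satisfying [G, Γ_i] ⊆ Γ_{i+1} for i = 1,…,r, such that Γ_i ⊆ A^4·Γ_{i+1} for each i = 1,…,r. -/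
open Pointwise

namespace S15

open scoped commutatorElement

def Step {G : Type*} [Group G] (A : Set G) (H K : Subgroup G) : Prop :=
  K ≤ H ∧ H.Normal ∧ K.Normal ∧ ⁅(⊤ : Subgroup G), H⁆ ≤ K ∧ (H : Set G) ⊆ A ^ 4 * (K : Set G)

theorem extract {G : Type*} [Group G] (A : Set G) (H K : Subgroup G)
    (h : Relation.ReflTransGen (Step A) H K) :
    ∃ (r : ℕ) (Γ : ℕ → Subgroup G), Γ 1 = H ∧ Γ (r + 1) = K ∧
      ∀ i, 1 ≤ i → i ≤ r → Step A (Γ i) (Γ (i + 1)) := by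
  induction h using Relation.ReflTransGen.head_induction_on with
  | refl => exact ⟨0, fun _ => K, rfl, rfl, fun i h1 h2 => by omega⟩
  | head hac _ ih =>
    rename_i a c _
    obtain ⟨r, Γ, h1, h2, h3⟩ := ih
    refine ⟨r + 1, fun i => if i ≤ 1 then a else Γ (i - 1), by simp, by simp [h2], ?_⟩
    intro i hi hir
    rcases Nat.eq_or_lt_of_le hi with rfl | hi'
    · simpa [h1] using hac
    · obtain ⟨j, rfl⟩ : ∃ j, i = j + 1 := ⟨i - 1, by omega⟩
      have := h3 j (by omega) (by omega)
      have hj : j ≠ 0 := by omega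
      simpa [hj] using this

theorem comm_mem {G : Type*} [Group G] (A : Set G) (hsym : A⁻¹ = A)
    (hAZ : A * (Subgroup.center G : Set G) = Set.univ) (x y : G) : ⁅x, y⁆ ∈ A ^ 4 := by
  obtain ⟨a, ha, z, hz, rfl⟩ : x ∈ A * (Subgroup.center G : Set G) := hAZ ▸ Set.mem_univ x
  obtain ⟨b, hb, w, hw, rfl⟩ : y ∈ A * (Subgroup.center G : Set G) := hAZ ▸ Set.mem_univ y
  have hz' := Subgroup.mem_center_iff.1 hz
  have hw' := Subgroup.mem_center_iff.1 hw
  have : ⁅a * z, b * w⁆ = a * b * a⁻¹ * b⁻¹ := by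
    rw [commutatorElement_def]
    calc a * z * (b * w) * (a * z)⁻¹ * (b * w)⁻¹
        = a * (z * (b * w)) * (z⁻¹ * a⁻¹) * (w⁻¹ * b⁻¹) := by group
      _ = a * ((b * w) * z) * (z⁻¹ * a⁻¹) * (w⁻¹ * b⁻¹) := by rw [hz' (b * w)]
      _ = a * b * (w * a⁻¹) * (w⁻¹ * b⁻¹) := by group
      _ = a * b * (a⁻¹ * w) * (w⁻¹ * b⁻¹) := by rw [hw' a⁻¹]
      _ = _ := by group
  have ha' : a⁻¹ ∈ A := by rw [← hsym]; simpa using ha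
  have hb' : b⁻¹ ∈ A := by rw [← hsym]; simpa using hb
  show ⁅a * z, b * w⁆ ∈ A ^ 4
  rw [this, pow_succ, pow_succ, pow_succ, pow_one]
  exact Set.mul_mem_mul (Set.mul_mem_mul (Set.mul_mem_mul ha hb) ha') hb'

section
variable {G : Type*} [Group G]

local notation "L" => Subgroup.lowerCentralSeries (⊤ : Subgroup G)

theorem comm_lcs (n : ℕ) (g y : G) (hy : y ∈ L n) : ⁅g, y⁆ ∈ L (n + 1) := by
  have : ⁅y, g⁆ ∈ L (n + 1) := Subgroup.commutator_mem_commutator hy (Subgroup.mem_top g)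
  rw [← commutatorElement_inv]
  exact inv_mem this

theorem comm_top_le (n : ℕ) (K : Subgroup G) (h2 : K ≤ L n) :
    ⁅(⊤ : Subgroup G), K⁆ ≤ L (n + 1) :=
  Subgroup.commutator_le.2 fun g _ k hk => comm_lcs n g k (h2 hk)

theorem normal_between (n : ℕ) (K : Subgroup G) (h1 : L (n + 1) ≤ K) (h2 : K ≤ L n) :
    K.Normal := ⟨fun k hk g => by
  have : g * k * g⁻¹ = ⁅g, k⁆ * k := by rw [commutatorElement_def]; group
  rw [this]
  exact mul_mem (h1 (comm_lcs n g k (h2 hk))) hk⟩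

def Hx (n : ℕ) (x : G) : Subgroup G where
  carrier := {g | ∃ y ∈ L n, ⁅x, y⁆⁻¹ * g ∈ L (n + 2)}
  one_mem' := ⟨1, one_mem _, by simp⟩
  mul_mem' := by
    rintro a b ⟨y, hy, ha⟩ ⟨w, hw, hb⟩
    refine ⟨y * w, mul_mem hy hw, ?_⟩
    have hN : (L (n + 2)).Normal := inferInstance
    have e : ⁅x, y * w⁆⁻¹ * (a * b) =
      (⁅x, w⁆⁻¹ * (⁅y, ⁅x, w⁆⁆⁻¹ * (⁅x, y⁆⁻¹ * a)) * ⁅x, w⁆⁻¹⁻¹) * (⁅x, w⁆⁻¹ * b) := by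
      simp only [commutatorElement_def]; group
    have hc : ⁅y, ⁅x, w⁆⁆ ∈ L (n + 2) := comm_lcs _ _ _ (comm_lcs _ _ _ hw)
    rw [e]
    exact mul_mem (hN.conj_mem _ (mul_mem (inv_mem hc) ha) _) hb
  inv_mem' := by
    rintro a ⟨y, hy, ha⟩
    refine ⟨y⁻¹, inv_mem hy, ?_⟩
    have hN : (L (n + 2)).Normal := inferInstance
    have hc : ⁅y⁻¹, ⁅x, y⁆⁻¹⁆ ∈ L (n + 2) :=
      comm_lcs _ _ _ (inv_mem (comm_lcs _ _ _ hy))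
    have e : ⁅x, y⁻¹⁆⁻¹ * a⁻¹ =
      (⁅x, y⁆ * ⁅y⁻¹, ⁅x, y⁆⁻¹⁆⁻¹ * ⁅x, y⁆⁻¹) * (⁅x, y⁆ * (⁅x, y⁆⁻¹ * a)⁻¹ * ⁅x, y⁆⁻¹) := by
      simp only [commutatorElement_def]; group
    rw [e]
    exact mul_mem (hN.conj_mem _ (inv_mem hc) _) (hN.conj_mem _ (inv_mem ha) _)

theorem Hx_le (n : ℕ) (x : G) : Hx n x ≤ L (n + 1) := by
  rintro g ⟨y, hy, h⟩
  have h1 := Subgroup.lowerCentralSeries_antitone (⊤ : Subgroup G) (Nat.le_succ (n + 1)) h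
  have h2 := mul_mem (comm_lcs n x y hy) h1
  rwa [mul_inv_cancel_left] at h2

theorem chainS (A : Set G) (hA : ∀ x y : G, ⁅x, y⁆ ∈ A ^ 4) (n : ℕ) (S : Finset G) :
    ∃ K : Subgroup G, L (n + 2) ≤ K ∧ K ≤ L (n + 1) ∧
      (∀ x ∈ S, ∀ y ∈ L n, ⁅x, y⁆ ∈ K) ∧ Relation.ReflTransGen (Step A) K (L (n + 2)) := by
  classical
  have hanti : L (n + 2) ≤ L (n + 1) :=
    Subgroup.lowerCentralSeries_antitone (⊤ : Subgroup G) (Nat.le_succ (n + 1))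
  induction S using Finset.induction_on with
  | empty => exact ⟨L (n + 2), le_rfl, hanti, by simp, .refl⟩
  | insert x S _ ih =>
    obtain ⟨K, h1, h2, h3, h4⟩ := ih
    have hK := normal_between (n + 1) K h1 h2
    have h2' : Hx n x ⊔ K ≤ L (n + 1) := sup_le (Hx_le n x) h2
    refine ⟨Hx n x ⊔ K, h1.trans le_sup_right, h2', ?_, .head ⟨le_sup_right,
      normal_between (n + 1) _ (h1.trans le_sup_right) h2', hK,
      (comm_top_le _ _ h2').trans h1, ?_⟩ h4⟩
    · intro z hz y hy
      rcases Finset.mem_insert.1 hz with rfl | hz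
      · exact Subgroup.mem_sup_left ⟨y, hy, by rw [inv_mul_cancel]; exact one_mem _⟩
      · exact Subgroup.mem_sup_right (h3 z hz y hy)
    · rw [Subgroup.mul_normal]
      rintro _ ⟨g, ⟨y, hy, hg⟩, k, hk, rfl⟩
      exact ⟨⁅x, y⁆, hA x y, ⁅x, y⁆⁻¹ * g * k, mul_mem (h1 hg) hk, by
        show ⁅x, y⁆ * (⁅x, y⁆⁻¹ * g * k) = g * k
        group⟩

theorem chainL (A : Set G) (hA : ∀ x y : G, ⁅x, y⁆ ∈ A ^ 4) (hfg : Group.FG G) (n : ℕ) :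
    Relation.ReflTransGen (Step A) (L (n + 1)) (L (n + 2)) := by
  obtain ⟨S, hS⟩ := hfg.out
  obtain ⟨K, h1, h2, h3, h4⟩ := chainS A hA n S
  have hK := normal_between (n + 1) K h1 h2
  suffices h : K = L (n + 1) by rwa [h] at h4
  refine le_antisymm h2 ?_
  have key : ∀ g : G, ∀ y ∈ L n, ⁅g, y⁆ ∈ K := by
    intro g
    have hg : g ∈ Subgroup.closure (S : Set G) := hS ▸ Subgroup.mem_top g
    induction hg using Subgroup.closure_induction with
    | mem x hx => exact h3 x hx
    | one => intro y _; simp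
    | mul a b _ _ ha hb =>
      intro y hy
      have : ⁅a * b, y⁆ = (a * ⁅b, y⁆ * a⁻¹) * ⁅a, y⁆ := by
        simp only [commutatorElement_def]; group
      rw [this]
      exact mul_mem (hK.conj_mem _ (hb y hy) _) (ha y hy)
    | inv a _ ha =>
      intro y hy
      have : ⁅a⁻¹, y⁆ = a⁻¹ * ⁅a, y⁆⁻¹ * a⁻¹⁻¹ := by
        simp only [commutatorElement_def]; group
      rw [this]
      exact hK.conj_mem _ (inv_mem (ha y hy)) _
  refine Subgroup.commutator_le.2 fun y hy g _ => ?_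
  rw [← commutatorElement_inv]
  exact inv_mem (key g y hy)

theorem chainAll (A : Set G) (hA : ∀ x y : G, ⁅x, y⁆ ∈ A ^ 4) (hfg : Group.FG G) (n : ℕ) :
    Relation.ReflTransGen (Step A) (L 1) (L (n + 1)) := by
  induction n with
  | zero => exact .refl
  | succ n ih => exact ih.trans (chainL A hA hfg n)

end

end S15

theorem statement_15 {G : Type*} [Group G] (hfg : Group.FG G)
    (hnilp : Group.IsNilpotent G) (A : Set G) (hsym : A⁻¹ = A)
    (hAZ : A * (Subgroup.center G : Set G) = Set.univ) :
    ∃ (r : ℕ) (Γ : ℕ → Subgroup G),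
      Γ 1 = commutator G ∧
      Γ (r + 1) = ⊥ ∧
      (∀ i, 1 ≤ i → i ≤ r → Γ (i + 1) ≤ Γ i) ∧
      (∀ i, 1 ≤ i → i ≤ r + 1 → (Γ i).Normal) ∧
      (∀ i, 1 ≤ i → i ≤ r → ⁅(⊤ : Subgroup G), Γ i⁆ ≤ Γ (i + 1)) ∧
      (∀ i, 1 ≤ i → i ≤ r → (Γ i : Set G) ⊆ A ^ 4 * (Γ (i + 1) : Set G)) := by
  obtain ⟨n, hn⟩ := Subgroup.nilpotent_iff_lowerCentralSeries.1 hnilp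
  have h := S15.chainAll A (S15.comm_mem A hsym hAZ) hfg n
  have hb : Subgroup.lowerCentralSeries (⊤ : Subgroup G) (n + 1) = ⊥ :=
    le_bot_iff.1 (hn ▸ Subgroup.lowerCentralSeries_antitone (⊤ : Subgroup G) (Nat.le_succ n))
  rw [hb] at h
  obtain ⟨r, Γ, h1, h2, h3⟩ := S15.extract A _ _ h
  refine ⟨r, Γ, ?_, h2, fun i a b => (h3 i a b).1, ?_, fun i a b => (h3 i a b).2.2.2.1,
    fun i a b => (h3 i a b).2.2.2.2⟩
  · rw [h1]; rfl
  · intro i a b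
    rcases Nat.eq_or_lt_of_le b with rfl | b
    · rw [h2]; infer_instance
    · exact (h3 i a (by omega)).2.1
end

section
/- Let G and N be groups, let π : G → N be a homomorphism, and let A ⊆ G be a symmetric set containing the identity. Then: (1) if A^2 ∩ ker π = {1} then π is injective on A; (2) if A^3 ∩ ker π = {1} and H is a subgroup of N with H ⊆ π(A), then there exists a subgroup H' of G with H' ⊆ A such that the restriction of π to H' is an isomorphism from H' onto H. -/
open Pointwise

theorem statement_18 {G N : Type*} [Group G] [Group N] (π : G →* N)
    (A : Set G) (hsym : A⁻¹ = A) (h1 : (1 : G) ∈ A) :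
    ((A ^ 2 ∩ (π.ker : Set G) = {1}) → Set.InjOn π A) ∧
    ((A ^ 3 ∩ (π.ker : Set G) = {1}) →
      ∀ H : Subgroup N, (H : Set N) ⊆ π '' A →
        ∃ H' : Subgroup G, (H' : Set G) ⊆ A ∧
          Set.BijOn π (H' : Set G) (H : Set N)) := by
  have hinv : ∀ a ∈ A, a⁻¹ ∈ A := by
    intro a ha
    rw [← hsym]
    simpa using ha
  have key : ((A ^ 2 ∩ (π.ker : Set G) = {1}) → Set.InjOn π A) := by
    intro h a ha b hb hab
    have hm : a * b⁻¹ ∈ A ^ 2 ∩ (π.ker : Set G) := by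
      refine ⟨?_, ?_⟩
      · rw [pow_two]
        exact Set.mul_mem_mul ha (hinv b hb)
      · simp [MonoidHom.mem_ker, hab]
    rw [h] at hm
    exact mul_inv_eq_one.mp hm
  refine ⟨key, ?_⟩
  intro h H hH
  have key3 : ∀ a ∈ A, ∀ b ∈ A, ∀ c ∈ A, π (a * b) = π c → a * b = c := by
    intro a ha b hb c hc hab
    have hm : a * b * c⁻¹ ∈ A ^ 3 ∩ (π.ker : Set G) := by
      refine ⟨?_, ?_⟩
      · rw [pow_succ, pow_two]
        exact Set.mul_mem_mul (Set.mul_mem_mul ha hb) (hinv c hc)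
      · rw [SetLike.mem_coe, MonoidHom.mem_ker, map_mul, hab, map_inv, mul_inv_cancel]
    rw [h] at hm
    exact mul_inv_eq_one.mp hm
  refine ⟨{ carrier := {a | a ∈ A ∧ π a ∈ H}
            mul_mem' := ?_
            one_mem' := ⟨h1, by simp⟩
            inv_mem' := ?_ }, ?_, ?_, ?_, ?_⟩
  · rintro a b ⟨ha, ha'⟩ ⟨hb, hb'⟩
    have hab : π (a * b) ∈ H := by
      rw [map_mul]
      exact H.mul_mem ha' hb'
    obtain ⟨c, hc, hc'⟩ := hH hab
    refine ⟨?_, hab⟩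
    rw [key3 a ha b hb c hc hc'.symm]
    exact hc
  · rintro a ⟨ha, ha'⟩
    refine ⟨hinv a ha, ?_⟩
    rw [map_inv]
    exact H.inv_mem ha'
  · rintro a ⟨ha, -⟩
    exact ha
  · rintro a ⟨-, ha⟩
    exact ha
  · rintro a ⟨ha, -⟩ b ⟨hb, -⟩ hab
    have := key3 a ha 1 h1 b hb (by simpa using hab)
    simpa using this
  · intro x hx
    obtain ⟨c, hc, hc'⟩ := hH hx
    exact ⟨c, ⟨hc, by rw [hc']; exact hx⟩, hc'⟩
end

section
/- Let G and N be groups, let π : G → N be a homomorphism, and let A ⊆ G be a symmetric set containing the identity such that A^4 ∩ ker π = {1}. Let H be a subgroup of N with H ⊆ π(A), and let H' be a subgroup of G with H' ⊆ A such that π restricts to an isomorphism from H' onto H. Then H' is a normal subgroup of ⟨A⟩ if and only if H is a normal subgroup of ⟨π(A)⟩. -/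
open Pointwise

theorem statement_19 {G N : Type*} [Group G] [Group N] (π : G →* N)
    (A : Set G) (hsym : A⁻¹ = A) (h1 : (1 : G) ∈ A)
    (hker : A ^ 4 ∩ (π.ker : Set G) = {1})
    (H : Subgroup N) (hH : (H : Set N) ⊆ π '' A)
    (H' : Subgroup G) (hH' : (H' : Set G) ⊆ A)
    (hiso : Set.BijOn π (H' : Set G) (H : Set N)) :
    (∀ g ∈ Subgroup.closure A, ∀ h ∈ H', g * h * g⁻¹ ∈ H') ↔
      (∀ n ∈ Subgroup.closure (π '' A), ∀ h ∈ H, n * h * n⁻¹ ∈ H) := by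
  constructor
  · intro hn n hnm h hh
    rw [← MonoidHom.map_closure] at hnm
    obtain ⟨g, hg, rfl⟩ := hnm
    obtain ⟨k, hk, rfl⟩ := hiso.surjOn hh
    have := hiso.mapsTo (hn g hg k hk)
    simpa using this
  · intro hn
    have hinv : ∀ a ∈ A, a⁻¹ ∈ A := by
      intro a ha
      rw [← hsym]
      simpa using ha
    have key : ∀ a ∈ A, ∀ h ∈ H', a * h * a⁻¹ ∈ H' := by
      intro a ha h hh
      have h2 := hn (π a) (Subgroup.subset_closure ⟨a, ha, rfl⟩) (π h) (hiso.mapsTo hh)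
      obtain ⟨k, hk, hk2⟩ := hiso.surjOn h2
      have h3 : a * h * a⁻¹ * k⁻¹ ∈ A ^ 4 ∩ (π.ker : Set G) := by
        refine ⟨?_, ?_⟩
        · simp only [pow_succ, pow_zero, one_mul]
          exact Set.mul_mem_mul (Set.mul_mem_mul (Set.mul_mem_mul ha (hH' hh)) (hinv a ha))
            (hH' (H'.inv_mem hk))
        · simp [MonoidHom.mem_ker, hk2]
      rw [hker] at h3
      have h4 : a * h * a⁻¹ = k := mul_inv_eq_one.mp h3
      rw [h4]; exact hk
    intro g hg
    induction hg using Subgroup.closure_induction'' with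
    | mem x hx => exact key x hx
    | inv_mem x hx => exact key _ (hinv x hx)
    | one => simp
    | mul x y _ _ hx hy =>
      intro h hh
      have := hx _ (hy h hh)
      simpa [mul_assoc] using this
end
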